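/- There is no C-code of length 8: there exists no set C₀ of 3 pairwise disjoint unordered pairs of nonzero elements of Z_8 = ℤ/8ℤ such that, setting C_i = {{x+i, y+i} : {x,y} ∈ C₀} for i ∈ Z_8, for all m ≠ k in Z_8 one has C_m ∩ C_k = ∅, the simple graph on vertex set Z_8 with edge set C_m ∪ C_k contains no cycle, and m and k lie in different connected components of that graph. -/

import Mathlib

/-! Common definitions: C-codes, even starters, even 2-starters,
and bipyramidal (perfect) one-factorizations of the graph `G_{2n+2}`. -/

/-- Translate each unordered pair in `C` by `i`. -/
def shiftSet {m : ℕ} (i : ZMod m) (C : Set (Sym2 (ZMod m))) : Set (Sym2 (ZMod m)) :=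
  (Sym2.map (· + i)) '' C

/-- `C` consists of `k` pairwise disjoint unordered pairs (2-element sets) of nonzero
elements of `ZMod m`. -/
def IsPairing (m k : ℕ) (C : Set (Sym2 (ZMod m))) : Prop :=
  C.ncard = k ∧ (∀ e ∈ C, ¬ e.IsDiag) ∧ (∀ e ∈ C, (0 : ZMod m) ∉ e) ∧
    (∀ e ∈ C, ∀ e' ∈ C, e ≠ e' → ∀ a, a ∈ e → a ∉ e')

/-- The defining condition of a C-code with columns `C_i = i + C0`:
for all `a ≠ b`, the columns `C_a` and `C_b` are disjoint, the graph on `ZMod m`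
with edge set `C_a ∪ C_b` has no cycle, and `a`, `b` are in different components. -/
def CCodeCond (m : ℕ) (C0 : Set (Sym2 (ZMod m))) : Prop :=
  ∀ a b : ZMod m, a ≠ b →
    shiftSet a C0 ∩ shiftSet b C0 = ∅ ∧
    (SimpleGraph.fromEdgeSet (shiftSet a C0 ∪ shiftSet b C0)).IsAcyclic ∧
    ¬ (SimpleGraph.fromEdgeSet (shiftSet a C0 ∪ shiftSet b C0)).Reachable a b

/-- `C0` defines a C-code of length `2n`. -/
def IsCCode (n : ℕ) (C0 : Set (Sym2 (ZMod (2*n)))) : Prop :=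
  IsPairing (2*n) (n-1) C0 ∧ CCodeCond (2*n) C0

/-- An even starter in `ZMod (2n)`. -/
def IsEvenStarter (n : ℕ) (S : Set (Sym2 (ZMod (2*n)))) : Prop :=
  IsPairing (2*n) (n-1) S ∧
  ∀ i : ZMod (2*n), i ≠ 0 → i ≠ (n : ZMod (2*n)) →
    ∃ x y : ZMod (2*n), s(x, y) ∈ S ∧ (i = x - y ∨ i = y - x)

/-- An even starter in `ZMod m` for even `m`, phrased with `n = m / 2`. -/
def IsEvenStarterMod (m : ℕ) (S : Set (Sym2 (ZMod m))) : Prop :=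
  IsPairing m (m / 2 - 1) S ∧
  ∀ i : ZMod m, i ≠ 0 → i ≠ ((m / 2 : ℕ) : ZMod m) →
    ∃ x y : ZMod m, s(x, y) ∈ S ∧ (i = x - y ∨ i = y - x)

/-- Vertices of `G_{2n+2}`: `Sum.inl i` for `i ∈ ZMod (2n)`, and `Sum.inr false = ∞₁`,
`Sum.inr true = ∞₂`. -/
abbrev Vtx (n : ℕ) : Type := ZMod (2*n) ⊕ Bool

/-- The graph `G_{2n+2}`: all pairs of distinct vertices are adjacent except
`{∞₁, ∞₂}` and the pairs `{i, i+n}` for `i ∈ ZMod (2n)`. -/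
def Ggraph (n : ℕ) : SimpleGraph (Vtx n) :=
  SimpleGraph.fromRel fun u v =>
    match u, v with
    | Sum.inl i, Sum.inl j => j ≠ i + (n : ZMod (2*n))
    | Sum.inl _, Sum.inr _ => True
    | Sum.inr _, Sum.inl _ => True
    | Sum.inr _, Sum.inr _ => False

/-- The permutation `σ^i` (rotation by `i` on `ZMod (2n)`, fixing `∞₁` and `∞₂`). -/
def vshift (n : ℕ) (i : ZMod (2*n)) : Vtx n → Vtx n
  | Sum.inl x => Sum.inl (x + i)
  | Sum.inr b => Sum.inr b

/-- The involution swapping `∞₁` and `∞₂` and fixing all elements of `ZMod (2n)`. -/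
def iotaSwap (n : ℕ) : Vtx n → Vtx n
  | Sum.inl x => Sum.inl x
  | Sum.inr b => Sum.inr (!b)

/-- `F` is a perfect matching (one-factor) of `G_{2n+2}`. -/
def IsOneFactor (n : ℕ) (F : Set (Sym2 (Vtx n))) : Prop :=
  F ⊆ (Ggraph n).edgeSet ∧ ∀ v : Vtx n, ∃! e, e ∈ F ∧ v ∈ e

/-- A bipyramidal one-factorization of `G_{2n+2}`: `2n` pairwise edge-disjoint
one-factors whose union is the whole edge set, with `F i = σ^i (F 0)`. -/
def IsBipyramidalOF (n : ℕ) (F : ZMod (2*n) → Set (Sym2 (Vtx n))) : Prop :=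
  (∀ i, IsOneFactor n (F i)) ∧ (∀ i j, i ≠ j → F i ∩ F j = ∅) ∧
    (⋃ i, F i) = (Ggraph n).edgeSet ∧
    ∀ i, F i = (Sym2.map (vshift n i)) '' (F 0)

/-- The graph with edge set `E` is a Hamiltonian cycle: it is connected and every
vertex has degree 2. -/
def IsHamCycleOn {V : Type} (E : Set (Sym2 V)) : Prop :=
  (SimpleGraph.fromEdgeSet E).Connected ∧
    ∀ v : V, ((SimpleGraph.fromEdgeSet E).neighborSet v).ncard = 2

/-- A bipyramidal perfect one-factorization of `G_{2n+2}`. -/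
def IsBipyramidalP1F (n : ℕ) (F : ZMod (2*n) → Set (Sym2 (Vtx n))) : Prop :=
  IsBipyramidalOF n F ∧ ∀ j k, j ≠ k → IsHamCycleOn (F j ∪ F k)

/-- An even starter in the multiplicative group `(ZMod p)ˣ`. -/
def IsMulEvenStarter (p : ℕ) (S : Set (Sym2 ((ZMod p)ˣ))) : Prop :=
  S.ncard = (p - 3) / 2 ∧ (∀ e ∈ S, ¬ e.IsDiag) ∧ (∀ e ∈ S, (1 : (ZMod p)ˣ) ∉ e) ∧
    (∀ e ∈ S, ∀ e' ∈ S, e ≠ e' → ∀ a, a ∈ e → a ∉ e') ∧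
    ∀ u : (ZMod p)ˣ, u ≠ 1 → u ≠ -1 →
      ∃ x y : (ZMod p)ˣ, s(x, y) ∈ S ∧ (u = x⁻¹ * y ∨ u = x * y⁻¹)

/-- The number of pairs in `S` whose difference (in either order) is `d`. -/
noncomputable def diffCount (m : ℕ) (d : ℕ) (S : Set (Sym2 (ZMod m))) : ℕ :=
  {e ∈ S | ∃ x y : ZMod m, e = s(x, y) ∧
    (y - x = (d : ZMod m) ∨ x - y = (d : ZMod m))}.ncard

/-- `(S0, S1)` is an even 2-starter in `ZMod (2n)`: each `Sᵢ` consists of `n-1`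
unordered pairs of elements of `ZMod (2n) \ {i}`, and every `d` with `1 ≤ d ≤ n-1`
occurs exactly twice as a difference of a pair, counted over both sets. -/
def IsEven2Starter (n : ℕ) (S0 S1 : Set (Sym2 (ZMod (2*n)))) : Prop :=
  S0.ncard = n - 1 ∧ S1.ncard = n - 1 ∧
    (∀ e ∈ S0, ¬ e.IsDiag) ∧ (∀ e ∈ S1, ¬ e.IsDiag) ∧
    (∀ e ∈ S0, (0 : ZMod (2*n)) ∉ e) ∧ (∀ e ∈ S1, (1 : ZMod (2*n)) ∉ e) ∧
    ∀ d : ℕ, 1 ≤ d → d ≤ n - 1 →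
      diffCount (2*n) d S0 + diffCount (2*n) d S1 = 2

/-- The `i`-th column induced by `(S0, S1)`:
`C_i = {{x + 2⌊ī/2⌋, y + 2⌊ī/2⌋} : {x,y} ∈ S_{ī mod 2}}` where `ī = i.val`. -/
def qCol (n : ℕ) (S0 S1 : Set (Sym2 (ZMod (2*n)))) (i : ZMod (2*n)) :
    Set (Sym2 (ZMod (2*n))) :=
  (Sym2.map (· + ((2 * (i.val / 2) : ℕ) : ZMod (2*n)))) ''
    (if i.val % 2 = 0 then S0 else S1)

/-- The quasi-C-code condition for the column family induced by `(S0, S1)`. -/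
def QuasiCCodeCond (n : ℕ) (S0 S1 : Set (Sym2 (ZMod (2*n)))) : Prop :=
  ∀ a b : ZMod (2*n), a ≠ b →
    qCol n S0 S1 a ∩ qCol n S0 S1 b = ∅ ∧
    (SimpleGraph.fromEdgeSet (qCol n S0 S1 a ∪ qCol n S0 S1 b)).IsAcyclic ∧
    ¬ (SimpleGraph.fromEdgeSet (qCol n S0 S1 a ∪ qCol n S0 S1 b)).Reachable a b

/-- The partner of `x` in the pairs `{a,a+1}`, `{b,b+2}`, `{c,c+3}` (or `x` itself). -/
def partner8 (a b c x : ZMod 8) : ZMod 8 :=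
  if x = a then a + 1 else if x = a + 1 then a else
  if x = b then b + 2 else if x = b + 2 then b else
  if x = c then c + 3 else if x = c + 3 then c else x

set_option maxRecDepth 100000 in
set_option maxHeartbeats 4000000 in
set_option synthInstance.maxHeartbeats 2000000 in
set_option synthInstance.maxSize 4096 in
theorem finite_check8 : ∀ a b c : ZMod 8,
    a ≠ 0 → a + 1 ≠ 0 → b ≠ 0 → b + 2 ≠ 0 → c ≠ 0 → c + 3 ≠ 0 →
    a ≠ b → a ≠ b + 2 → a + 1 ≠ b → a + 1 ≠ b + 2 →
    a ≠ c → a ≠ c + 3 → a + 1 ≠ c → a + 1 ≠ c + 3 →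
    b ≠ c → b ≠ c + 3 → b + 2 ≠ c → b + 2 ≠ c + 3 →
    ∃ k : ZMod 8, k ≠ 0 ∧
      (partner8 a b c (partner8 a b c (0 - k) + k) = k ∨
       partner8 a b c (partner8 a b c (partner8 a b c (partner8 a b c (0 - k) + k) - k) + k)
        = k) := by
  decide

theorem partner8_mem (C : Set (Sym2 (ZMod 8))) (a b c : ZMod 8) (ha : s(a, a + 1) ∈ C)
    (hb : s(b, b + 2) ∈ C) (hc : s(c, c + 3) ∈ C) (x : ZMod 8) :
    partner8 a b c x = x ∨ s(x, partner8 a b c x) ∈ C := by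
  unfold partner8
  split_ifs with h1 h2 h3 h4 h5 h6
  · subst h1; exact Or.inr ha
  · subst h2; rw [Sym2.eq_swap]; exact Or.inr ha
  · subst h3; exact Or.inr hb
  · subst h4; rw [Sym2.eq_swap]; exact Or.inr hb
  · subst h5; exact Or.inr hc
  · subst h6; rw [Sym2.eq_swap]; exact Or.inr hc
  · exact Or.inl rfl

theorem key8 (C : Set (Sym2 (ZMod 8))) (hP : IsPairing 8 3 C) (hC : CCodeCond 8 C)
    (a b c : ZMod 8) (ha : s(a, a + 1) ∈ C)
    (hb : s(b, b + 2) ∈ C) (hc : s(c, c + 3) ∈ C) : False := by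
  obtain ⟨-, -, h0, hd⟩ := hP
  have e12 : s(a, a + 1) ≠ s(b, b + 2) := by
    clear * -; revert a b; decide
  have e13 : s(a, a + 1) ≠ s(c, c + 3) := by
    clear * -; revert a c; decide
  have e23 : s(b, b + 2) ≠ s(c, c + 3) := by
    clear * -; revert b c; decide
  have z1 := h0 _ ha
  have z2 := h0 _ hb
  have z3 := h0 _ hc
  have d12 := hd _ ha _ hb e12
  have d13 := hd _ ha _ hc e13
  have d23 := hd _ hb _ hc e23
  simp only [Sym2.mem_iff, not_or, forall_eq_or_imp, forall_eq] at z1 z2 z3 d12 d13 d23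
  obtain ⟨k, hk, h⟩ := finite_check8 a b c (Ne.symm z1.1) (Ne.symm z1.2) (Ne.symm z2.1)
    (Ne.symm z2.2) (Ne.symm z3.1) (Ne.symm z3.2) d12.1.1 d12.1.2 d12.2.1 d12.2.2
    d13.1.1 d13.1.2 d13.2.1 d13.2.2 d23.1.1 d23.1.2 d23.2.1 d23.2.2
  obtain ⟨-, -, hr⟩ := hC 0 k (Ne.symm hk)
  apply hr
  set G := SimpleGraph.fromEdgeSet (shiftSet 0 C ∪ shiftSet k C) with hG
  have r1 : ∀ x, G.Reachable x (partner8 a b c x) := by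
    intro x
    rcases eq_or_ne (partner8 a b c x) x with h | h
    · rw [h]
    · have hm := (partner8_mem C a b c ha hb hc x).resolve_left h
      apply SimpleGraph.Adj.reachable
      rw [hG, SimpleGraph.fromEdgeSet_adj]
      exact ⟨Or.inl ⟨_, hm, by simp⟩, Ne.symm h⟩
  have r2 : ∀ x, G.Reachable x (partner8 a b c (x - k) + k) := by
    intro x
    rcases eq_or_ne (partner8 a b c (x - k)) (x - k) with h | h
    · rw [h, sub_add_cancel]
    · have hm := (partner8_mem C a b c ha hb hc (x - k)).resolve_left h
      apply SimpleGraph.Adj.reachable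
      rw [hG, SimpleGraph.fromEdgeSet_adj]
      refine ⟨Or.inr ⟨_, hm, by simp⟩, fun h' => h ?_⟩
      exact eq_sub_of_add_eq h'.symm
  have r3 := (r2 0).trans (r1 _)
  rcases h with h | h
  · rwa [h] at r3
  · have r4 := (r3.trans (r2 _)).trans (r1 _)
    rwa [h] at r4

theorem rep8 : ∀ x y : ZMod 8, x ≠ y → (∃ z, s(x, y) = s(z, z + 1)) ∨
    (∃ z, s(x, y) = s(z, z + 2)) ∨ (∃ z, s(x, y) = s(z, z + 3)) ∨ y = x + 4 := by
  decide

theorem rep8' (C : Set (Sym2 (ZMod 8))) (hP : IsPairing 8 3 C) (hC : CCodeCond 8 C)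
    (e : Sym2 (ZMod 8)) (he : e ∈ C) : (∃ z, e = s(z, z + 1)) ∨
    (∃ z, e = s(z, z + 2)) ∨ (∃ z, e = s(z, z + 3)) := by
  induction e with | _ x y
  have hne : x ≠ y := fun h => hP.2.1 _ he (by simpa using h)
  rcases rep8 x y hne with h | h | h | h
  · exact Or.inl h
  · exact Or.inr (Or.inl h)
  · exact Or.inr (Or.inr h)
  · exfalso
    subst h
    have h := (hC 0 4 (by decide)).1
    have : s(x, x + 4) ∈ shiftSet 0 C ∩ shiftSet 4 C := by
      refine ⟨⟨_, he, by simp⟩, ⟨_, he, ?_⟩⟩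
      clear * -; revert x; decide
    rw [h] at this
    exact this

theorem same8 (C : Set (Sym2 (ZMod 8))) (hC : CCodeCond 8 C) (d x y : ZMod 8)
    (hx : s(x, x + d) ∈ C) (hy : s(y, y + d) ∈ C) : x = y := by
  by_contra hne
  have h := (hC 0 (x - y) (fun h => hne (sub_eq_zero.1 h.symm))).1
  have : s(x, x + d) ∈ shiftSet 0 C ∩ shiftSet (x - y) C := by
    refine ⟨⟨_, hx, by simp⟩, ⟨_, hy, ?_⟩⟩
    have e1 : y + (x - y) = x := by ring
    have e2 : y + d + (x - y) = x + d := by ring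
    simp only [Sym2.map_mk, e1, e2]
  rw [h] at this
  exact this

/-- There is no C-code of length 8. -/
theorem stmt7 : ¬ ∃ C0 : Set (Sym2 (ZMod (2*4))), IsCCode 4 C0 := by
  rintro ⟨C, hP, hC⟩
  change Set (Sym2 (ZMod 8)) at C
  change IsPairing 8 3 C at hP
  change CCodeCond 8 C at hC
  have hK := key8 C hP hC
  obtain ⟨e, f, g, hef, heg, hfg, hs⟩ := Set.ncard_eq_three.1 hP.1
  have he : e ∈ C := by rw [hs]; simp
  have hf : f ∈ C := by rw [hs]; simp
  have hg : g ∈ C := by rw [hs]; simp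
  clear hs
  rcases rep8' C hP hC e he with ⟨x, rfl⟩ | ⟨x, rfl⟩ | ⟨x, rfl⟩ <;>
  rcases rep8' C hP hC f hf with ⟨y, rfl⟩ | ⟨y, rfl⟩ | ⟨y, rfl⟩ <;>
  rcases rep8' C hP hC g hg with ⟨z, rfl⟩ | ⟨z, rfl⟩ | ⟨z, rfl⟩ <;>
  first
  | exact hef (by rw [same8 C hC _ _ _ he hf])
  | exact heg (by rw [same8 C hC _ _ _ he hg])
  | exact hfg (by rw [same8 C hC _ _ _ hf hg])
  | exact hK _ _ _ he hf hg
  | exact hK _ _ _ he hg hf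
  | exact hK _ _ _ hf he hg
  | exact hK _ _ _ hf hg he
  | exact hK _ _ _ hg he hf
  | exact hK _ _ _ hg hf he
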